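/- Let A = ℂ[x_1, x_2, x_3, x_4], f = x_1·x_2·(x_1 + x_2)·(x_1 + x_2·x_3)·(x_1 + x_2·x_4), and g_j = ∂f/∂x_j for j = 1, 2, 3, 4. Then ker φ = (ker^{(1)}φ : f), i.e. for every p ∈ A[s, ξ_1, ξ_2, ξ_3, ξ_4] one has p ∈ ker φ if and only if f·p ∈ ker^{(1)}φ. -/

import Mathlib

open MvPolynomial

set_option synthInstance.maxHeartbeats 1000000
set_option maxHeartbeats 1000000

/-- The `A`-algebra map `φ : A[s, ξ_1, …, ξ_n] → A[t]` with `φ(s) = f·t` and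
`φ(ξ_j) = g_j·t`; variable `0` is `s` and variable `j.succ` is `ξ_j`. Its image is the
Rees algebra of the ideal `(f, g_1, …, g_n)`. -/
noncomputable def reesPhi {A : Type*} [CommRing A] {n : ℕ} (f : A) (g : Fin n → A) :
    MvPolynomial (Fin (n + 1)) A →ₐ[A] Polynomial A :=
  aeval (Fin.cons (Polynomial.C f * Polynomial.X) fun j => Polynomial.C (g j) * Polynomial.X)

/-- `ker^{(1)} φ`: the ideal of `A[s, ξ_1, …, ξ_n]` generated by the homogeneous
elements of degree `1` lying in `ker φ`. -/
noncomputable def kerOne {A : Type*} [CommRing A] {n : ℕ} (f : A) (g : Fin n → A) :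
    Ideal (MvPolynomial (Fin (n + 1)) A) :=
  Ideal.span {p | p ∈ RingHom.ker (reesPhi f g) ∧ p.IsHomogeneous 1}

/-- The equation of the "five lines" divisor in `ℂ^4`:
`f = x_1·x_2·(x_1 + x_2)·(x_1 + x_2·x_3)·(x_1 + x_2·x_4)`. -/
noncomputable def fiveLines : MvPolynomial (Fin 4) ℂ :=
  X 0 * X 1 * (X 0 + X 1) * (X 0 + X 1 * X 2) * (X 0 + X 1 * X 3)

/-- The Koszul complex on `u, v, w` is exact in degree one modulo the ideal `I`. -/
def KoszulExact {R : Type*} [CommRing R] (I : Ideal R) (u v w : R) : Prop :=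
  ∀ a b c, a * u + b * v + c * w ∈ I →
    ∃ k l m, a - (k * v + l * w) ∈ I ∧ b - (-k * u + m * w) ∈ I ∧ c - (-l * u - m * v) ∈ I

section Koszul

variable {R : Type*} [CommRing R]

theorem KoszulExact.of_isPrime {S : Set R} {u v w : R}
    (h0 : (Ideal.span S).IsPrime) (hu : u ∉ Ideal.span S)
    (h1 : (Ideal.span (insert u S)).IsPrime) (hv : v ∉ Ideal.span (insert u S))
    (h2 : (Ideal.span (insert v (insert u S))).IsPrime)
    (hw : w ∉ Ideal.span (insert v (insert u S))) : KoszulExact (Ideal.span S) u v w := by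
  intro a b c h
  have hc : c ∈ Ideal.span (insert v (insert u S)) := by
    refine (h2.mem_or_mem ?_).resolve_right hw
    refine Ideal.mem_span_insert.2 ⟨-b, -a * u + (a * u + b * v + c * w),
      Ideal.mem_span_insert.2 ⟨-a, _, h, rfl⟩, by ring⟩
  obtain ⟨α, _, hz, rfl⟩ := Ideal.mem_span_insert.1 hc
  obtain ⟨β, i, hi, rfl⟩ := Ideal.mem_span_insert.1 hz
  have h' : (a + β * w) * u + (b + α * w) * v ∈ Ideal.span S := by
    have := sub_mem h (Ideal.mul_mem_right w _ hi)
    convert this using 1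
    ring
  have hb : b + α * w ∈ Ideal.span (insert u S) := by
    refine (h1.mem_or_mem ?_).resolve_right hv
    exact Ideal.mem_span_insert.2 ⟨-(a + β * w), _, h', by ring⟩
  obtain ⟨γ, j, hj, hbj⟩ := Ideal.mem_span_insert.1 hb
  have ha : a + β * w + γ * v ∈ Ideal.span S := by
    refine (h0.mem_or_mem ?_).resolve_right hu
    have := sub_mem h' (Ideal.mul_mem_right v _ hj)
    convert this using 1
    linear_combination (-v) * hbj
  refine ⟨-γ, -β, -α, ?_, ?_, ?_⟩
  · convert ha using 1
    ring
  · convert hj using 1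
    linear_combination hbj
  · convert hi using 1
    ring

theorem KoszulExact.mul_left {I : Ideal R} {u u' v w : R} (h : KoszulExact I u v w)
    (h' : KoszulExact I u' v w) : KoszulExact I (u * u') v w := by
  intro a b c habc
  obtain ⟨k, l, m, h1, h2, h3⟩ := h (a * u') b c (by convert habc using 1; ring)
  obtain ⟨k', l', m', h1', h2', h3'⟩ := h' a (-k) (-l) (by convert h1 using 1; ring)
  refine ⟨k', l', m' * u + m, h1', ?_, ?_⟩
  · convert add_mem h2 (I.mul_mem_left u h2') using 1
    ring
  · convert add_mem h3 (I.mul_mem_left u h3') using 1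
    ring

theorem KoszulExact.swap {I : Ideal R} {u v w : R} (h : KoszulExact I u v w) :
    KoszulExact I v u w := by
  intro a b c habc
  obtain ⟨k, l, m, h1, h2, h3⟩ := h b a c (by convert habc using 1; ring)
  refine ⟨-k, m, l, h2, ?_, ?_⟩
  · convert h1 using 1
    ring
  · convert h3 using 1
    ring

theorem KoszulExact.of_sub_mul_mem {I : Ideal R} {u v w s c d : R} (h : KoszulExact I u v w)
    (hcd : c * d = 1) (hs : s - c * u ∈ I) : KoszulExact I s v w := by
  intro a b e habe
  obtain ⟨k, l, m, h1, h2, h3⟩ := h a (d * b) (d * e) (by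
    convert sub_mem (I.mul_mem_left d habe) (I.mul_mem_left (d * a) hs) using 1
    linear_combination (-a * u) * hcd)
  refine ⟨k, l, c * m, h1, ?_, ?_⟩
  · convert add_mem (I.mul_mem_left c h2) (I.mul_mem_left k hs) using 1
    linear_combination (-b) * hcd
  · convert add_mem (I.mul_mem_left c h3) (I.mul_mem_left l hs) using 1
    linear_combination (-e) * hcd

theorem KoszulExact.sub_left {I : Ideal R} {s u v : R} (h : KoszulExact I s u v) :
    KoszulExact I (-s) (u - s) (v - s) := by
  intro a b c habc
  obtain ⟨k, l, m, h1, h2, h3⟩ := h (-(a + b + c)) b c (by convert habc using 1; ring)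
  refine ⟨m - k, -(m + l), m, ?_, ?_, ?_⟩
  · convert neg_mem (add_mem h1 (add_mem h2 h3)) using 1
    ring
  · convert h2 using 1
    ring
  · convert h3 using 1
    ring

/-- If `J` is generated by `e` and three combinations `ℓ * aᵢ + c * bᵢ`, then `J : ℓ` is contained
in the ideal obtained by adjoining the `2 × 2` minors of the matrix of coefficients. -/
theorem mem_of_mul_mem_of_koszulExact [IsDomain R] {J Q : Ideal R}
    {l c e a₁ b₁ a₂ b₂ a₃ b₃ p : R}
    (hl : (Ideal.span {l}).IsPrime) (hl0 : l ≠ 0) (he : e ∉ Ideal.span {l})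
    (hI : (Ideal.span {l, e}).IsPrime) (hc : c ∉ Ideal.span {l, e})
    (hK : KoszulExact (Ideal.span {l, e}) b₁ b₂ b₃)
    (hJ : J ≤ Ideal.span {e, l * a₁ + c * b₁, l * a₂ + c * b₂, l * a₃ + c * b₃})
    (he' : e ∈ Q) (h₁ : l * a₁ + c * b₁ ∈ Q) (h₂ : l * a₂ + c * b₂ ∈ Q)
    (h₃ : l * a₃ + c * b₃ ∈ Q) (h₁₂ : a₁ * b₂ - a₂ * b₁ ∈ Q) (h₁₃ : a₁ * b₃ - a₃ * b₁ ∈ Q)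
    (h₂₃ : a₂ * b₃ - a₃ * b₂ ∈ Q) (hp : l * p ∈ J) : p ∈ Q := by
  obtain ⟨t, _, hp₁, hp⟩ := Ideal.mem_span_insert.1 (hJ hp)
  obtain ⟨r₁, _, hp₂, rfl⟩ := Ideal.mem_span_insert.1 hp₁
  obtain ⟨r₂, _, hp₃, rfl⟩ := Ideal.mem_span_insert.1 hp₂
  obtain ⟨r₃, rfl⟩ := Ideal.mem_span_singleton'.1 hp₃
  have hr : r₁ * b₁ + r₂ * b₂ + r₃ * b₃ ∈ Ideal.span {l, e} := by
    refine (hI.mem_or_mem (x := c) ?_).resolve_left hc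
    exact Ideal.mem_span_pair.2 ⟨p - r₁ * a₁ - r₂ * a₂ - r₃ * a₃, -t, by linear_combination hp⟩
  obtain ⟨k, m, n, hr₁, hr₂, hr₃⟩ := hK _ _ _ hr
  obtain ⟨x₁, y₁, hr₁⟩ := Ideal.mem_span_pair.1 hr₁
  obtain ⟨x₂, y₂, hr₂⟩ := Ideal.mem_span_pair.1 hr₂
  obtain ⟨x₃, y₃, hr₃⟩ := Ideal.mem_span_pair.1 hr₃
  set q := k * (a₁ * b₂ - a₂ * b₁) + m * (a₁ * b₃ - a₃ * b₁) + n * (a₂ * b₃ - a₃ * b₂) +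
    x₁ * (l * a₁ + c * b₁) + x₂ * (l * a₂ + c * b₂) + x₃ * (l * a₃ + c * b₃) with hq
  set g := t + y₁ * (l * a₁ + c * b₁) + y₂ * (l * a₂ + c * b₂) + y₃ * (l * a₃ + c * b₃) with hg
  have hqQ : q ∈ Q :=
    add_mem (add_mem (add_mem (add_mem (add_mem (Q.mul_mem_left _ h₁₂) (Q.mul_mem_left _ h₁₃))
      (Q.mul_mem_left _ h₂₃)) (Q.mul_mem_left _ h₁)) (Q.mul_mem_left _ h₂)) (Q.mul_mem_left _ h₃)
  have hge : l * (p - q) = g * e := by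
    rw [hq, hg]
    linear_combination hp - (l * a₁ + c * b₁) * hr₁ - (l * a₂ + c * b₂) * hr₂ -
      (l * a₃ + c * b₃) * hr₃
  have hgl : g ∈ Ideal.span {l} := by
    refine (hl.mem_or_mem ?_).resolve_right he
    exact Ideal.mem_span_singleton'.2 ⟨p - q, by rw [← hge]; ring⟩
  obtain ⟨g', hg'⟩ := Ideal.mem_span_singleton'.1 hgl
  have : p - q = g' * e := mul_left_cancel₀ hl0 (by rw [hge, ← hg']; ring)
  rw [show p = g' * e + q by rw [← this]; ring]
  exact add_mem (Q.mul_mem_left _ he') hqQ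

/-- A Hilbert–Burch statement for the `2 × 2` minors of the matrix with rows
`(Z, W, V)` and `(z * Z, w * W, V)`. -/
theorem exists_of_minors_mem {S : Set R} {z w Z W V b₁ b₂ b₃ : R}
    (h0 : (Ideal.span S).IsPrime) (hwz0 : w - z ∉ Ideal.span S) (hw0 : 1 - w ∉ Ideal.span S)
    (hZ0 : Z ∉ Ideal.span S) (hW0 : W ∉ Ideal.span S)
    (hZ : (Ideal.span (insert Z S)).IsPrime)
    (hZ' : (1 - w) * W * V ∉ Ideal.span (insert Z S))
    (hW : (Ideal.span (insert W S)).IsPrime)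
    (hW' : (1 - z) * Z * V ∉ Ideal.span (insert W S))
    (hwz : (Ideal.span (insert (w - z) S)).IsPrime) (hwz' : V ∉ Ideal.span (insert (w - z) S))
    (hw : (Ideal.span (insert (1 - w) S)).IsPrime)
    (hw' : 1 - z ∉ Ideal.span (insert (1 - w) S))
    (h : b₁ * ((w - z) * Z * W) + b₂ * ((1 - z) * Z * V) + b₃ * ((1 - w) * W * V) ∈
      Ideal.span S) :
    ∃ e d, b₁ + e * V ∈ Ideal.span S ∧ b₂ - W * (e + (1 - w) * d) ∈ Ideal.span S ∧
      b₃ + Z * (e + (1 - z) * d) ∈ Ideal.span S := by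
  have hb₃ : b₃ ∈ Ideal.span (insert Z S) :=
    (hZ.mem_or_mem (Ideal.mem_span_insert.2
      ⟨-(b₁ * ((w - z) * W) + b₂ * ((1 - z) * V)), _, h, by ring⟩)).resolve_right hZ'
  have hb₂ : b₂ ∈ Ideal.span (insert W S) :=
    (hW.mem_or_mem (Ideal.mem_span_insert.2
      ⟨-(b₁ * ((w - z) * Z) + b₃ * ((1 - w) * V)), _, h, by ring⟩)).resolve_right hW'
  obtain ⟨c₃, i₃, hi₃, rfl⟩ := Ideal.mem_span_insert.1 hb₃
  obtain ⟨c₂, i₂, hi₂, rfl⟩ := Ideal.mem_span_insert.1 hb₂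
  have h1 : b₁ * (w - z) + (c₂ * (1 - z) + c₃ * (1 - w)) * V ∈ Ideal.span S := by
    refine (h0.mem_or_mem (?_ : W * _ ∈ _)).resolve_left hW0
    refine (h0.mem_or_mem (?_ : Z * _ ∈ _)).resolve_left hZ0
    convert sub_mem (sub_mem h (Ideal.mul_mem_right ((1 - z) * Z * V) _ hi₂))
      (Ideal.mul_mem_right ((1 - w) * W * V) _ hi₃) using 1
    ring
  have h2 : c₂ * (1 - z) + c₃ * (1 - w) ∈ Ideal.span (insert (w - z) S) :=
    (hwz.mem_or_mem (Ideal.mem_span_insert.2 ⟨-b₁, _, h1, by ring⟩)).resolve_right hwz'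
  obtain ⟨e, i, hi, hei⟩ := Ideal.mem_span_insert.1 h2
  have h3 : b₁ + e * V ∈ Ideal.span S := by
    refine (h0.mem_or_mem (?_ : (w - z) * _ ∈ _)).resolve_left hwz0
    convert sub_mem h1 (Ideal.mul_mem_right V _ hi) using 1
    linear_combination (-V) * hei
  have h4 : c₂ - e ∈ Ideal.span (insert (1 - w) S) :=
    (hw.mem_or_mem (Ideal.mem_span_insert.2
      ⟨-(c₃ + e), _, hi, by linear_combination hei⟩)).resolve_right hw'
  obtain ⟨d, j, hj, hdj⟩ := Ideal.mem_span_insert.1 h4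
  have h5 : c₃ + e + d * (1 - z) ∈ Ideal.span S := by
    refine (h0.mem_or_mem (?_ : (1 - w) * _ ∈ _)).resolve_left hw0
    convert sub_mem hi (Ideal.mul_mem_right (1 - z) _ hj) using 1
    linear_combination hei - (1 - z) * hdj
  refine ⟨e, d, h3, ?_, ?_⟩
  · convert add_mem (Ideal.mul_mem_left _ W hj) hi₂ using 1
    linear_combination W * hdj
  · convert add_mem (Ideal.mul_mem_left _ Z h5) hi₃ using 1
    ring

end Koszul

namespace FiveLines

/-- The coordinate ring `A[s, ξ_1, …, ξ_4]`. -/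
def CotangentRing : Type := MvPolynomial (Fin 5) (MvPolynomial (Fin 4) ℂ)

noncomputable instance : CommRing CotangentRing :=
  inferInstanceAs (CommRing (MvPolynomial (Fin 5) (MvPolynomial (Fin 4) ℂ)))

instance : IsDomain CotangentRing :=
  inferInstanceAs (IsDomain (MvPolynomial (Fin 5) (MvPolynomial (Fin 4) ℂ)))

/-- The inclusion of the base ring `A`. -/
noncomputable def base : MvPolynomial (Fin 4) ℂ →+* CotangentRing :=
  (C : MvPolynomial (Fin 4) ℂ →+* MvPolynomial (Fin 5) (MvPolynomial (Fin 4) ℂ))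

/-- The variables `s, ξ_1, …, ξ_4`. -/
noncomputable def var (i : Fin 5) : CotangentRing :=
  (X i : MvPolynomial (Fin 5) (MvPolynomial (Fin 4) ℂ))

noncomputable instance : Algebra ℂ CotangentRing := (base.comp C).toAlgebra

noncomputable def x : CotangentRing := base (X 0)
noncomputable def y : CotangentRing := base (X 1)
noncomputable def z : CotangentRing := base (X 2)
noncomputable def w : CotangentRing := base (X 3)
noncomputable def s : CotangentRing := var 0
noncomputable def dx : CotangentRing := var 1
noncomputable def dy : CotangentRing := var 2
noncomputable def dz : CotangentRing := var 3
noncomputable def dw : CotangentRing := var 4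
noncomputable def fifth : CotangentRing := algebraMap ℂ CotangentRing (1 / 5)

theorem five_mul_fifth : (5 : CotangentRing) * fifth = 1 := by
  rw [fifth, ← map_ofNat (algebraMap ℂ CotangentRing) 5, ← map_mul]
  norm_num

section Specialize

variable {T : Type*} [CommRing T] [Algebra ℂ T]

/-- The ring homomorphism with prescribed values on `ℂ` and on the variables. -/
noncomputable def lift (a : Fin 4 → T) (b : Fin 5 → T) : CotangentRing →+* T :=
  (eval₂Hom (aeval a).toRingHom b : MvPolynomial (Fin 5) (MvPolynomial (Fin 4) ℂ) →+* T)

@[simp] theorem lift_base (a : Fin 4 → T) (b : Fin 5 → T) (p : MvPolynomial (Fin 4) ℂ) :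
    lift a b (base p) = aeval a p :=
  eval₂Hom_C _ _ _

@[simp] theorem lift_var (a : Fin 4 → T) (b : Fin 5 → T) (i : Fin 5) :
    lift a b (var i) = b i :=
  eval₂Hom_X' _ _ _

/-- Evaluation of `x, y, z, w, s, dx, dy, dz, dw` at the given elements. -/
noncomputable def specialize (a₀ a₁ a₂ a₃ b₀ b₁ b₂ b₃ b₄ : T) : CotangentRing →+* T :=
  lift ![a₀, a₁, a₂, a₃] ![b₀, b₁, b₂, b₃, b₄]

variable (a₀ a₁ a₂ a₃ b₀ b₁ b₂ b₃ b₄ : T)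

@[simp] theorem specialize_x : specialize a₀ a₁ a₂ a₃ b₀ b₁ b₂ b₃ b₄ x = a₀ := by
  simp [specialize, x]
@[simp] theorem specialize_y : specialize a₀ a₁ a₂ a₃ b₀ b₁ b₂ b₃ b₄ y = a₁ := by
  simp [specialize, y]
@[simp] theorem specialize_z : specialize a₀ a₁ a₂ a₃ b₀ b₁ b₂ b₃ b₄ z = a₂ := by
  simp [specialize, z]
@[simp] theorem specialize_w : specialize a₀ a₁ a₂ a₃ b₀ b₁ b₂ b₃ b₄ w = a₃ := by
  simp [specialize, w]
@[simp] theorem specialize_s : specialize a₀ a₁ a₂ a₃ b₀ b₁ b₂ b₃ b₄ s = b₀ := by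
  simp [specialize, s]
@[simp] theorem specialize_dx : specialize a₀ a₁ a₂ a₃ b₀ b₁ b₂ b₃ b₄ dx = b₁ := by
  simp [specialize, dx]
@[simp] theorem specialize_dy : specialize a₀ a₁ a₂ a₃ b₀ b₁ b₂ b₃ b₄ dy = b₂ := by
  simp [specialize, dy]
@[simp] theorem specialize_dz : specialize a₀ a₁ a₂ a₃ b₀ b₁ b₂ b₃ b₄ dz = b₃ := by
  simp [specialize, dz]
@[simp] theorem specialize_dw : specialize a₀ a₁ a₂ a₃ b₀ b₁ b₂ b₃ b₄ dw = b₄ := by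
  simp [specialize, dw]

@[simp] theorem specialize_algebraMap (r : ℂ) :
    specialize a₀ a₁ a₂ a₃ b₀ b₁ b₂ b₃ b₄ (algebraMap ℂ CotangentRing r) = algebraMap ℂ T r := by
  change specialize a₀ a₁ a₂ a₃ b₀ b₁ b₂ b₃ b₄ (base (C r)) = _
  simp [specialize]

end Specialize

@[simp] theorem specialize_fifth (a₀ a₁ a₂ a₃ b₀ b₁ b₂ b₃ b₄ : CotangentRing) :
    specialize a₀ a₁ a₂ a₃ b₀ b₁ b₂ b₃ b₄ fifth = fifth :=
  specialize_algebraMap ..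

@[simp] theorem specialize_fifth_complex (a₀ a₁ a₂ a₃ b₀ b₁ b₂ b₃ b₄ : ℂ) :
    specialize a₀ a₁ a₂ a₃ b₀ b₁ b₂ b₃ b₄ fifth = 1 / 5 :=
  specialize_algebraMap ..

theorem hom_ext {T : Type*} [CommRing T] {f g : CotangentRing →+* T}
    (hC : ∀ r : ℂ, f (algebraMap ℂ _ r) = g (algebraMap ℂ _ r)) (hx : f x = g x) (hy : f y = g y)
    (hz : f z = g z) (hw : f w = g w) (hs : f s = g s) (hdx : f dx = g dx) (hdy : f dy = g dy)
    (hdz : f dz = g dz) (hdw : f dw = g dw) : f = g := by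
  have hbase : f.comp base = g.comp base := by
    apply MvPolynomial.ringHom_ext hC
    intro i
    fin_cases i
    exacts [hx, hy, hz, hw]
  refine MvPolynomial.ringHom_ext (R := MvPolynomial (Fin 4) ℂ) (σ := Fin 5)
    (fun r => congrArg (fun h : _ →+* T => h r) hbase) ?_
  intro i
  fin_cases i
  exacts [hs, hdx, hdy, hdz, hdw]

/-- An ideal defining the graph of a substitution is prime. -/
theorem isPrime_span {G : Set CotangentRing} (a₀ a₁ a₂ a₃ b₀ b₁ b₂ b₃ b₄ : CotangentRing)
    (hG : ∀ g ∈ G, specialize a₀ a₁ a₂ a₃ b₀ b₁ b₂ b₃ b₄ g = 0)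
    (hx : x - a₀ ∈ Ideal.span G) (hy : y - a₁ ∈ Ideal.span G) (hz : z - a₂ ∈ Ideal.span G)
    (hw : w - a₃ ∈ Ideal.span G) (hs : s - b₀ ∈ Ideal.span G) (hdx : dx - b₁ ∈ Ideal.span G)
    (hdy : dy - b₂ ∈ Ideal.span G) (hdz : dz - b₃ ∈ Ideal.span G)
    (hdw : dw - b₄ ∈ Ideal.span G) : (Ideal.span G).IsPrime := by
  have hmk : (Ideal.Quotient.mk (Ideal.span G)) =
      (Ideal.Quotient.mk (Ideal.span G)).comp (specialize a₀ a₁ a₂ a₃ b₀ b₁ b₂ b₃ b₄) := by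
    apply hom_ext <;> simp only [RingHom.comp_apply, specialize_x, specialize_y, specialize_z,
      specialize_w, specialize_s, specialize_dx, specialize_dy, specialize_dz, specialize_dw,
      specialize_algebraMap]
    · simp
    all_goals rwa [Ideal.Quotient.eq]
  have : Ideal.span G = RingHom.ker (specialize a₀ a₁ a₂ a₃ b₀ b₁ b₂ b₃ b₄) := by
    apply le_antisymm
    · exact Ideal.span_le.2 hG
    · intro p hp
      rw [← Ideal.Quotient.eq_zero_iff_mem, hmk, RingHom.comp_apply, RingHom.mem_ker.1 hp, map_zero]
  rw [this]
  exact RingHom.ker_isPrime _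

theorem notMem_span {G : Set CotangentRing} {p : CotangentRing} (a₀ a₁ a₂ a₃ b₀ b₁ b₂ b₃ b₄ : ℂ)
    (hG : ∀ g ∈ G, specialize a₀ a₁ a₂ a₃ b₀ b₁ b₂ b₃ b₄ g = 0)
    (hp : specialize a₀ a₁ a₂ a₃ b₀ b₁ b₂ b₃ b₄ p ≠ 0) : p ∉ Ideal.span G :=
  fun h => hp ((Ideal.span_le (I := RingHom.ker (specialize a₀ a₁ a₂ a₃ b₀ b₁ b₂ b₃ b₄))).2 hG h)

theorem mem_span_single {R : Type*} [CommRing R] {e₁ p : R} (c₁ : R)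
    (h : p = c₁ * e₁) : p ∈ Ideal.span {e₁} :=
  Ideal.mem_span_singleton'.2 ⟨c₁, h.symm⟩

theorem mem_span_double {R : Type*} [CommRing R] {e₁ e₂ p : R} (c₁ c₂ : R)
    (h : p = c₁ * e₁ + c₂ * e₂) : p ∈ Ideal.span {e₁, e₂} :=
  Ideal.mem_span_pair.2 ⟨c₁, c₂, h.symm⟩

theorem mem_span_triple {R : Type*} [CommRing R] {e₁ e₂ e₃ p : R} (c₁ c₂ c₃ : R)
    (h : p = c₁ * e₁ + c₂ * e₂ + c₃ * e₃) : p ∈ Ideal.span {e₁, e₂, e₃} :=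
  Submodule.mem_span_triple.2 ⟨c₁, c₂, c₃, h.symm⟩

theorem mem_span_quadruple {R : Type*} [CommRing R] {e₁ e₂ e₃ e₄ p : R} (c₁ c₂ c₃ c₄ : R)
    (h : p = c₁ * e₁ + c₂ * e₂ + c₃ * e₃ + c₄ * e₄) : p ∈ Ideal.span {e₁, e₂, e₃, e₄} := by
  rw [h]
  exact add_mem (add_mem (add_mem (Ideal.mul_mem_left _ _ (Ideal.subset_span (by simp)))
    (Ideal.mul_mem_left _ _ (Ideal.subset_span (by simp))))
    (Ideal.mul_mem_left _ _ (Ideal.subset_span (by simp))))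
    (Ideal.mul_mem_left _ _ (Ideal.subset_span (by simp)))

/-- The element with `φ(dv) = y * f / (x + y) * t`. -/
noncomputable def dv : CotangentRing := y * dy - z * dz - w * dw - s
noncomputable def e₁ : CotangentRing := fifth * (x * dx + y * dy) - s
noncomputable def e₂ : CotangentRing := (x + y * z) * dz - y * s
noncomputable def e₃ : CotangentRing := (x + y * w) * dw - y * s
noncomputable def e₄ : CotangentRing := (x + y) * dv - y * s
noncomputable def q₁ : CotangentRing := (w - z) * dz * dw - s * (dz - dw)
noncomputable def q₂ : CotangentRing := (1 - z) * dz * dv - s * (dz - dv)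
noncomputable def q₃ : CotangentRing := (1 - w) * dw * dv - s * (dw - dv)

/-- The ideal generated by the linear relations. -/
noncomputable def linearIdeal : Ideal CotangentRing := Ideal.span {e₁, e₂, e₃, e₄}

/-- The residual intersection of `linearIdeal` with respect to `(x, y)`. -/
noncomputable def residualIdeal : Ideal CotangentRing :=
  Ideal.span {e₁, e₂, e₃, e₄, q₁, q₂, q₃}

theorem e₁_mem : e₁ ∈ residualIdeal := Ideal.subset_span (by simp)
theorem e₂_mem : e₂ ∈ residualIdeal := Ideal.subset_span (by simp)
theorem e₃_mem : e₃ ∈ residualIdeal := Ideal.subset_span (by simp)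
theorem e₄_mem : e₄ ∈ residualIdeal := Ideal.subset_span (by simp)
theorem q₁_mem : q₁ ∈ residualIdeal := Ideal.subset_span (by simp)
theorem q₂_mem : q₂ ∈ residualIdeal := Ideal.subset_span (by simp)
theorem q₃_mem : q₃ ∈ residualIdeal := Ideal.subset_span (by simp)

theorem linearIdeal_le : linearIdeal ≤ residualIdeal :=
  Ideal.span_le.2 (by
    simp only [Set.insert_subset_iff, Set.singleton_subset_iff, SetLike.mem_coe]
    exact ⟨e₁_mem, e₂_mem, e₃_mem, e₄_mem⟩)

theorem y_mul_mem {p : CotangentRing} (hp : p ∈ residualIdeal) : y * p ∈ linearIdeal := by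
  have h : residualIdeal ≤ linearIdeal.colon {y} := by
    rw [residualIdeal, Ideal.span_le]
    simp only [Set.insert_subset_iff, Set.singleton_subset_iff, SetLike.mem_coe,
      Submodule.mem_colon_singleton, smul_eq_mul, linearIdeal]
    refine ⟨mem_span_quadruple y 0 0 0 ?_, mem_span_quadruple 0 y 0 0 ?_,
      mem_span_quadruple 0 0 y 0 ?_, mem_span_quadruple 0 0 0 y ?_,
      mem_span_quadruple 0 (-dw) dz 0 ?_, mem_span_quadruple 0 (-dv) 0 dz ?_,
      mem_span_quadruple 0 0 (-dv) dw ?_⟩ <;> simp only [e₁, e₂, e₃, e₄, q₁, q₂, q₃] <;> ring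
  simpa [Submodule.mem_colon_singleton, mul_comm] using h hp

theorem x_mul_minors_mem : x * q₁ ∈ linearIdeal ∧ x * q₂ ∈ linearIdeal ∧ x * q₃ ∈ linearIdeal := by
  refine ⟨mem_span_quadruple 0 (w * dw - s) (s - z * dz) 0 ?_,
    mem_span_quadruple 0 (dv - s) 0 (s - z * dz) ?_,
    mem_span_quadruple 0 0 (dv - s) (s - w * dw) ?_⟩ <;>
  simp only [e₁, e₂, e₃, e₄, q₁, q₂, q₃] <;> ring

section Primes

theorem isPrime_y : (Ideal.span {y} : Ideal CotangentRing).IsPrime := by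
  refine isPrime_span x 0 z w s dx dy dz dw ?_ ?_ ?_ ?_ ?_ ?_ ?_ ?_ ?_ ?_
  · simp
  · simp
  · exact mem_span_single 1 (by ring)
  · simp
  · simp
  · simp
  · simp
  · simp
  · simp
  · simp

theorem isPrime_y_e₁ : (Ideal.span {y, e₁} : Ideal CotangentRing).IsPrime := by
  refine isPrime_span x 0 z w (fifth * (x * dx)) dx dy dz dw ?_ ?_ ?_ ?_ ?_ ?_ ?_ ?_ ?_ ?_
  · simp [e₁]
  · simp
  · exact mem_span_double 1 0 (by ring)
  · simp
  · simp
  · exact mem_span_double (fifth * dy) (-1) (by rw [e₁]; ring)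
  · simp
  · simp
  · simp
  · simp

theorem isPrime_dz_y_e₁ : (Ideal.span {dz, y, e₁} : Ideal CotangentRing).IsPrime := by
  refine isPrime_span x 0 z w (fifth * (x * dx)) dx dy 0 dw ?_ ?_ ?_ ?_ ?_ ?_ ?_ ?_ ?_ ?_
  · simp [e₁]
  · simp
  · exact mem_span_triple 0 1 0 (by ring)
  · simp
  · simp
  · exact mem_span_triple 0 (fifth * dy) (-1) (by rw [e₁]; ring)
  · simp
  · simp
  · exact mem_span_triple 1 0 0 (by ring)
  · simp

theorem isPrime_dw_dz_y_e₁ : (Ideal.span {dw, dz, y, e₁} : Ideal CotangentRing).IsPrime := by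
  refine isPrime_span x 0 z w (fifth * (x * dx)) dx dy 0 0 ?_ ?_ ?_ ?_ ?_ ?_ ?_ ?_ ?_ ?_
  · simp [e₁]
  · simp
  · exact mem_span_quadruple 0 0 1 0 (by ring)
  · simp
  · simp
  · exact mem_span_quadruple 0 0 (fifth * dy) (-1) (by rw [e₁]; ring)
  · simp
  · simp
  · exact mem_span_quadruple 0 1 0 0 (by ring)
  · exact mem_span_quadruple 1 0 0 0 (by ring)

theorem isPrime_x_y_e₁ : (Ideal.span {x, y, e₁} : Ideal CotangentRing).IsPrime := by
  refine isPrime_span 0 0 z w 0 dx dy dz dw ?_ ?_ ?_ ?_ ?_ ?_ ?_ ?_ ?_ ?_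
  · simp [e₁]
  · exact mem_span_triple 1 0 0 (by ring)
  · exact mem_span_triple 0 1 0 (by ring)
  · simp
  · simp
  · exact mem_span_triple (fifth * dx) (fifth * dy) (-1) (by rw [e₁]; ring)
  · simp
  · simp
  · simp
  · simp

theorem isPrime_dz_x_y_e₁ : (Ideal.span {dz, x, y, e₁} : Ideal CotangentRing).IsPrime := by
  refine isPrime_span 0 0 z w 0 dx dy 0 dw ?_ ?_ ?_ ?_ ?_ ?_ ?_ ?_ ?_ ?_
  · simp [e₁]
  · exact mem_span_quadruple 0 1 0 0 (by ring)
  · exact mem_span_quadruple 0 0 1 0 (by ring)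
  · simp
  · simp
  · exact mem_span_quadruple 0 (fifth * dx) (fifth * dy) (-1) (by rw [e₁]; ring)
  · simp
  · simp
  · exact mem_span_quadruple 1 0 0 0 (by ring)
  · simp

theorem isPrime_dw_x_y_e₁ : (Ideal.span {dw, x, y, e₁} : Ideal CotangentRing).IsPrime := by
  refine isPrime_span 0 0 z w 0 dx dy dz 0 ?_ ?_ ?_ ?_ ?_ ?_ ?_ ?_ ?_ ?_
  · simp [e₁]
  · exact mem_span_quadruple 0 1 0 0 (by ring)
  · exact mem_span_quadruple 0 0 1 0 (by ring)
  · simp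
  · simp
  · exact mem_span_quadruple 0 (fifth * dx) (fifth * dy) (-1) (by rw [e₁]; ring)
  · simp
  · simp
  · simp
  · exact mem_span_quadruple 1 0 0 0 (by ring)

theorem isPrime_sub_x_y_e₁ : (Ideal.span {w - z, x, y, e₁} : Ideal CotangentRing).IsPrime := by
  refine isPrime_span 0 0 z z 0 dx dy dz dw ?_ ?_ ?_ ?_ ?_ ?_ ?_ ?_ ?_ ?_
  · simp [e₁]
  · exact mem_span_quadruple 0 1 0 0 (by ring)
  · exact mem_span_quadruple 0 0 1 0 (by ring)
  · simp
  · exact mem_span_quadruple 1 0 0 0 (by ring)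
  · exact mem_span_quadruple 0 (fifth * dx) (fifth * dy) (-1) (by rw [e₁]; ring)
  · simp
  · simp
  · simp
  · simp

theorem isPrime_one_sub_x_y_e₁ : (Ideal.span {1 - w, x, y, e₁} : Ideal CotangentRing).IsPrime := by
  refine isPrime_span 0 0 z 1 0 dx dy dz dw ?_ ?_ ?_ ?_ ?_ ?_ ?_ ?_ ?_ ?_
  · simp [e₁]
  · exact mem_span_quadruple 0 1 0 0 (by ring)
  · exact mem_span_quadruple 0 0 1 0 (by ring)
  · simp
  · exact mem_span_quadruple (-1) 0 0 0 (by ring)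
  · exact mem_span_quadruple 0 (fifth * dx) (fifth * dy) (-1) (by rw [e₁]; ring)
  · simp
  · simp
  · simp
  · simp

theorem isPrime_line : (Ideal.span {x + y * z} : Ideal CotangentRing).IsPrime := by
  refine isPrime_span (-(y * z)) y z w s dx dy dz dw ?_ ?_ ?_ ?_ ?_ ?_ ?_ ?_ ?_ ?_
  · simp
  · exact mem_span_single 1 (by ring)
  · simp
  · simp
  · simp
  · simp
  · simp
  · simp
  · simp
  · simp

theorem isPrime_line_e₁ : (Ideal.span {x + y * z, e₁} : Ideal CotangentRing).IsPrime := by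
  refine isPrime_span (-(y * z)) y z w (fifth * (y * (dy - z * dx))) dx dy dz dw
    ?_ ?_ ?_ ?_ ?_ ?_ ?_ ?_ ?_ ?_
  · simp [e₁]
    ring
  · exact mem_span_double 1 0 (by ring)
  · simp
  · simp
  · simp
  · exact mem_span_double (fifth * dx) (-1) (by rw [e₁]; ring)
  · simp
  · simp
  · simp
  · simp

theorem isPrime_y_line_e₁ : (Ideal.span {y, x + y * z, e₁} : Ideal CotangentRing).IsPrime := by
  refine isPrime_span 0 0 z w 0 dx dy dz dw ?_ ?_ ?_ ?_ ?_ ?_ ?_ ?_ ?_ ?_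
  · simp [e₁]
  · exact mem_span_triple (-z) 1 0 (by ring)
  · exact mem_span_triple 1 0 0 (by ring)
  · simp
  · simp
  · exact mem_span_triple (fifth * (dy - dx * z)) (fifth * dx) (-1) (by rw [e₁]; ring)
  · simp
  · simp
  · simp
  · simp

theorem isPrime_sigma_line_e₁ :
    (Ideal.span {dy - z * dx, x + y * z, e₁} : Ideal CotangentRing).IsPrime := by
  refine isPrime_span (-(y * z)) y z w 0 dx (z * dx) dz dw ?_ ?_ ?_ ?_ ?_ ?_ ?_ ?_ ?_ ?_
  · simp [e₁]
    exact Or.inr (by ring)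
  · exact mem_span_triple 0 1 0 (by ring)
  · simp
  · simp
  · simp
  · exact mem_span_triple (fifth * y) (fifth * dx) (-1) (by rw [e₁]; ring)
  · simp
  · exact mem_span_triple 1 0 0 (by ring)
  · simp
  · simp

theorem isPrime_sub_y_line_e₁ :
    (Ideal.span {w - z, y, x + y * z, e₁} : Ideal CotangentRing).IsPrime := by
  refine isPrime_span 0 0 z z 0 dx dy dz dw ?_ ?_ ?_ ?_ ?_ ?_ ?_ ?_ ?_ ?_
  · simp [e₁]
  · exact mem_span_quadruple 0 (-z) 1 0 (by ring)
  · exact mem_span_quadruple 0 1 0 0 (by ring)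
  · simp
  · exact mem_span_quadruple 1 0 0 0 (by ring)
  · exact mem_span_quadruple 0 (fifth * (dy - dx * z)) (fifth * dx) (-1) (by rw [e₁]; ring)
  · simp
  · simp
  · simp
  · simp

theorem isPrime_dw_y_line_e₁ :
    (Ideal.span {dw, y, x + y * z, e₁} : Ideal CotangentRing).IsPrime := by
  refine isPrime_span 0 0 z w 0 dx dy dz 0 ?_ ?_ ?_ ?_ ?_ ?_ ?_ ?_ ?_ ?_
  · simp [e₁]
  · exact mem_span_quadruple 0 (-z) 1 0 (by ring)
  · exact mem_span_quadruple 0 1 0 0 (by ring)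
  · simp
  · simp
  · exact mem_span_quadruple 0 (fifth * (dy - dx * z)) (fifth * dx) (-1) (by rw [e₁]; ring)
  · simp
  · simp
  · simp
  · exact mem_span_quadruple 1 0 0 0 (by ring)

theorem isPrime_sub_sigma_line_e₁ :
    (Ideal.span {w - z, dy - z * dx, x + y * z, e₁} : Ideal CotangentRing).IsPrime := by
  refine isPrime_span (-(y * z)) y z z 0 dx (z * dx) dz dw ?_ ?_ ?_ ?_ ?_ ?_ ?_ ?_ ?_ ?_
  · simp [e₁]
    exact Or.inr (by ring)
  · exact mem_span_quadruple 0 0 1 0 (by ring)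
  · simp
  · simp
  · exact mem_span_quadruple 1 0 0 0 (by ring)
  · exact mem_span_quadruple 0 (fifth * y) (fifth * dx) (-1) (by rw [e₁]; ring)
  · simp
  · exact mem_span_quadruple 0 1 0 0 (by ring)
  · simp
  · simp

theorem isPrime_dw_sigma_line_e₁ :
    (Ideal.span {dw, dy - z * dx, x + y * z, e₁} : Ideal CotangentRing).IsPrime := by
  refine isPrime_span (-(y * z)) y z w 0 dx (z * dx) dz 0 ?_ ?_ ?_ ?_ ?_ ?_ ?_ ?_ ?_ ?_
  · simp [e₁]
    exact Or.inr (by ring)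
  · exact mem_span_quadruple 0 0 1 0 (by ring)
  · simp
  · simp
  · simp
  · exact mem_span_quadruple 0 (fifth * y) (fifth * dx) (-1) (by rw [e₁]; ring)
  · simp
  · exact mem_span_quadruple 0 1 0 0 (by ring)
  · simp
  · exact mem_span_quadruple 1 0 0 0 (by ring)

end Primes

section NonZeroDivisors

theorem residualIdeal_le_iff {I : Ideal CotangentRing} :
    residualIdeal ≤ I ↔ e₁ ∈ I ∧ e₂ ∈ I ∧ e₃ ∈ I ∧ e₄ ∈ I ∧ q₁ ∈ I ∧ q₂ ∈ I ∧ q₃ ∈ I := by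
  simp only [residualIdeal, Ideal.span_le, Set.insert_subset_iff, Set.singleton_subset_iff,
    SetLike.mem_coe]

theorem linearIdeal_le_iff {I : Ideal CotangentRing} :
    linearIdeal ≤ I ↔ e₁ ∈ I ∧ e₂ ∈ I ∧ e₃ ∈ I ∧ e₄ ∈ I := by
  simp only [linearIdeal, Ideal.span_le, Set.insert_subset_iff, Set.singleton_subset_iff,
    SetLike.mem_coe]

theorem koszulExact_y : KoszulExact (Ideal.span {y, e₁}) dz dw dv := by
  refine .of_isPrime isPrime_y_e₁ ?_ isPrime_dz_y_e₁ ?_ isPrime_dw_dz_y_e₁ ?_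
  · exact notMem_span 0 0 0 0 0 0 0 1 0 (by simp [e₁]) (by simp)
  · exact notMem_span 0 0 0 0 0 0 0 0 1 (by simp [e₁]) (by simp)
  · exact notMem_span 5 0 0 0 1 1 0 0 0 (by simp [e₁]) (by simp [dv])

theorem mem_of_y_mul_mem_linearIdeal {p : CotangentRing} (hp : y * p ∈ linearIdeal) :
    p ∈ residualIdeal := by
  have h₂ : y * (z * dz - s) + x * dz = e₂ := by rw [e₂]; ring
  have h₃ : y * (w * dw - s) + x * dw = e₃ := by rw [e₃]; ring
  have h₄ : y * (dv - s) + x * dv = e₄ := by rw [e₄]; ring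
  refine mem_of_mul_mem_of_koszulExact (c := x) (e := e₁) (a₁ := z * dz - s) (a₂ := w * dw - s)
    (a₃ := dv - s) isPrime_y ?_ ?_ isPrime_y_e₁ ?_ koszulExact_y ?_ e₁_mem ?_ ?_ ?_ ?_ ?_ ?_ hp
  · intro h
    simpa using congrArg (specialize (0 : ℂ) 1 0 0 0 0 0 0 0) h
  · exact notMem_span 0 0 0 0 1 0 0 0 0 (by simp) (by simp [e₁])
  · exact notMem_span 1 0 0 0 0 0 0 0 0 (by simp [e₁]) (by simp)
  · rw [h₂, h₃, h₄]
    exact le_rfl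
  · rw [h₂]
    exact e₂_mem
  · rw [h₃]
    exact e₃_mem
  · rw [h₄]
    exact e₄_mem
  · convert neg_mem q₁_mem using 1
    rw [q₁]
    ring
  · convert neg_mem q₂_mem using 1
    rw [q₂]
    ring
  · convert neg_mem q₃_mem using 1
    rw [q₃]
    ring

theorem s_mem : s ∈ Ideal.span {x, y, e₁} :=
  mem_span_triple (fifth * dx) (fifth * dy) (-1) (by rw [e₁]; ring)

theorem minors_syzygy {b₁ b₂ b₃ : CotangentRing}
    (h : b₁ * q₁ + b₂ * q₂ + b₃ * q₃ ∈ Ideal.span {x, y, e₁}) :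
    ∃ e d, b₁ + e * dv ∈ Ideal.span {x, y, e₁} ∧
      b₂ - dw * (e + (1 - w) * d) ∈ Ideal.span {x, y, e₁} ∧
      b₃ + dz * (e + (1 - z) * d) ∈ Ideal.span {x, y, e₁} := by
  refine exists_of_minors_mem isPrime_x_y_e₁ ?_ ?_ ?_ ?_ isPrime_dz_x_y_e₁ ?_ isPrime_dw_x_y_e₁ ?_
    isPrime_sub_x_y_e₁ ?_ isPrime_one_sub_x_y_e₁ ?_ ?_
  · exact notMem_span 0 0 0 1 0 0 0 0 0 (by simp [e₁]) (by simp)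
  · exact notMem_span 0 0 0 0 0 0 0 0 0 (by simp [e₁]) (by simp)
  · exact notMem_span 0 0 0 0 0 0 0 1 0 (by simp [e₁]) (by simp)
  · exact notMem_span 0 0 0 0 0 0 0 0 1 (by simp [e₁]) (by simp)
  · exact notMem_span 0 0 0 2 0 0 0 0 1 (by simp [e₁]) (by simp [dv]; norm_num)
  · exact notMem_span 0 0 2 0 0 0 0 1 0 (by simp [e₁]) (by simp [dv]; norm_num)
  · exact notMem_span 0 0 1 1 0 0 0 1 0 (by simp [e₁]) (by simp [dv])
  · exact notMem_span 0 0 0 1 0 0 0 0 0 (by simp [e₁]) (by simp)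
  · convert add_mem h (Ideal.mul_mem_left _
      (b₁ * (dz - dw) + b₂ * (dz - dv) + b₃ * (dw - dv)) s_mem) using 1
    simp only [q₁, q₂, q₃]
    ring

theorem mem_of_y_mul_mem {p : CotangentRing} (hp : y * p ∈ residualIdeal) :
    p ∈ residualIdeal := by
  have hsplit : ∃ b₁ b₂ b₃, y * p - (b₁ * q₁ + b₂ * q₂ + b₃ * q₃) ∈ linearIdeal := by
    obtain ⟨c₁, _, h₁, hp⟩ := Ideal.mem_span_insert.1 hp
    obtain ⟨c₂, _, h₂, rfl⟩ := Ideal.mem_span_insert.1 h₁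
    obtain ⟨c₃, _, h₃, rfl⟩ := Ideal.mem_span_insert.1 h₂
    obtain ⟨c₄, _, h₄, rfl⟩ := Ideal.mem_span_insert.1 h₃
    obtain ⟨b₁, b₂, b₃, rfl⟩ := Submodule.mem_span_triple.1 h₄
    refine ⟨b₁, b₂, b₃, mem_span_quadruple c₁ c₂ c₃ c₄ ?_⟩
    linear_combination hp
  obtain ⟨b₁, b₂, b₃, hb⟩ := hsplit
  have hle : linearIdeal ≤ Ideal.span {x, y, e₁} := by
    refine linearIdeal_le_iff.2 ⟨mem_span_triple 0 0 1 (by ring),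
      mem_span_triple dz (z * dz - s) 0 ?_, mem_span_triple dw (w * dw - s) 0 ?_,
      mem_span_triple dv (dv - s) 0 ?_⟩ <;>
    simp only [e₂, e₃, e₄] <;> ring
  have hbq : b₁ * q₁ + b₂ * q₂ + b₃ * q₃ ∈ Ideal.span {x, y, e₁} := by
    convert sub_mem (Ideal.mul_mem_left _ p (Ideal.subset_span (by simp : y ∈ _))) (hle hb) using 1
    ring
  obtain ⟨e, d, h₁, h₂, h₃⟩ := minors_syzygy hbq
  have h₁' := add_mem h₁ (Ideal.mul_mem_left _ d s_mem)
  have h₂' := sub_mem h₂ (Ideal.mul_mem_left _ d s_mem)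
  have h₃' := add_mem h₃ (Ideal.mul_mem_left _ d s_mem)
  obtain ⟨i₁, j₁, k₁, h₁'⟩ := Submodule.mem_span_triple.1 h₁'
  obtain ⟨i₂, j₂, k₂, h₂'⟩ := Submodule.mem_span_triple.1 h₂'
  obtain ⟨i₃, j₃, k₃, h₃'⟩ := Submodule.mem_span_triple.1 h₃'
  simp only [smul_eq_mul] at h₁' h₂' h₃'
  obtain ⟨hx₁, hx₂, hx₃⟩ := x_mul_minors_mem
  have he₁ : e₁ ∈ linearIdeal := Ideal.subset_span (by simp)
  have hr : y * (p - (j₁ * q₁ + j₂ * q₂ + j₃ * q₃)) ∈ linearIdeal := by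
    have := add_mem hb (add_mem (add_mem (add_mem (Ideal.mul_mem_left _ i₁ hx₁)
      (Ideal.mul_mem_left _ i₂ hx₂)) (Ideal.mul_mem_left _ i₃ hx₃))
      (Ideal.mul_mem_left _ (k₁ * q₁ + k₂ * q₂ + k₃ * q₃) he₁))
    convert this using 1
    have hsyz : (-e * dv - d * s) * q₁ + (dw * (e + (1 - w) * d) + d * s) * q₂ +
        (-dz * (e + (1 - z) * d) - d * s) * q₃ = 0 := by
      simp only [q₁, q₂, q₃]
      ring
    linear_combination (-q₁) * h₁' - q₂ * h₂' - q₃ * h₃' + hsyz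
  have := add_mem (mem_of_y_mul_mem_linearIdeal hr)
    (add_mem (add_mem (Ideal.mul_mem_left _ j₁ q₁_mem) (Ideal.mul_mem_left _ j₂ q₂_mem))
      (Ideal.mul_mem_left _ j₃ q₃_mem))
  simpa using this

theorem koszulExact_line :
    KoszulExact (Ideal.span {x + y * z, e₁}) (-s) ((w - z) * dw - s) ((1 - z) * dv - s) := by
  refine .sub_left (.of_sub_mul_mem (u := y * (dy - z * dx)) (d := 5) ?_
    (mul_comm (5 : CotangentRing) fifth ▸ five_mul_fifth)
    (mem_span_double (fifth * dx) (-1) (by rw [e₁]; ring)))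
  refine .mul_left (.swap (.mul_left (.swap ?_) (.swap ?_)))
    (.swap (.mul_left (.swap ?_) (.swap ?_)))
  · refine .of_isPrime isPrime_line_e₁ ?_ isPrime_y_line_e₁ ?_ isPrime_sub_y_line_e₁ ?_
    · exact notMem_span 0 1 0 0 0 0 0 0 0 (by simp [e₁]) (by simp)
    · exact notMem_span 0 0 0 1 0 0 0 0 0 (by simp [e₁]) (by simp)
    · exact notMem_span 0 0 2 2 0 0 0 1 0 (by simp [e₁]) (by simp [dv]; norm_num)
  · refine .of_isPrime isPrime_line_e₁ ?_ isPrime_y_line_e₁ ?_ isPrime_dw_y_line_e₁ ?_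
    · exact notMem_span 0 1 0 0 0 0 0 0 0 (by simp [e₁]) (by simp)
    · exact notMem_span 0 0 0 0 0 0 0 0 1 (by simp [e₁]) (by simp)
    · exact notMem_span 0 0 2 0 0 0 0 1 0 (by simp [e₁]) (by simp [dv]; norm_num)
  · refine .of_isPrime isPrime_line_e₁ ?_ isPrime_sigma_line_e₁ ?_ isPrime_sub_sigma_line_e₁ ?_
    · exact notMem_span 0 0 0 0 0 0 1 0 0 (by simp [e₁]) (by simp)
    · exact notMem_span 0 0 0 1 0 0 0 0 0 (by simp [e₁]) (by simp)
    · exact notMem_span 0 0 2 2 0 0 0 1 0 (by simp [e₁]) (by simp [dv]; norm_num)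
  · refine .of_isPrime isPrime_line_e₁ ?_ isPrime_sigma_line_e₁ ?_ isPrime_dw_sigma_line_e₁ ?_
    · exact notMem_span 0 0 0 0 0 0 1 0 0 (by simp [e₁]) (by simp)
    · exact notMem_span 0 0 0 0 0 0 0 0 1 (by simp [e₁]) (by simp)
    · exact notMem_span 0 0 2 0 0 0 0 1 0 (by simp [e₁]) (by simp [dv]; norm_num)

theorem mem_of_line_mul_mem {p : CotangentRing} (hp : (x + y * z) * p ∈ residualIdeal) :
    p ∈ residualIdeal := by
  have h₂ : (x + y * z) * dz + y * -s = e₂ := by rw [e₂]; ring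
  have h₃ : (x + y * z) * dw + y * ((w - z) * dw - s) = e₃ := by rw [e₃]; ring
  have h₄ : (x + y * z) * dv + y * ((1 - z) * dv - s) = e₄ := by rw [e₄]; ring
  have hp' : (x + y * z) * (y * p) ∈ linearIdeal := by
    convert y_mul_mem hp using 1
    ring
  refine mem_of_y_mul_mem (mem_of_mul_mem_of_koszulExact (c := y) (e := e₁) (a₁ := dz) (a₂ := dw)
    (a₃ := dv) isPrime_line ?_ ?_ isPrime_line_e₁ ?_ koszulExact_line ?_ e₁_mem ?_ ?_ ?_ ?_ ?_ ?_
    hp')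
  · intro h
    simpa using congrArg (specialize (1 : ℂ) 0 0 0 0 0 0 0 0) h
  · exact notMem_span 0 0 0 0 1 0 0 0 0 (by simp) (by simp [e₁])
  · exact notMem_span 0 1 0 0 0 0 0 0 0 (by simp [e₁]) (by simp)
  · rw [h₂, h₃, h₄]
    exact le_rfl
  · rw [h₂]
    exact e₂_mem
  · rw [h₃]
    exact e₃_mem
  · rw [h₄]
    exact e₄_mem
  · convert q₁_mem using 1
    rw [q₁]
    ring
  · convert q₂_mem using 1
    rw [q₂]
    ring
  · convert q₃_mem using 1
    rw [q₃]
    ring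

/-- The involution exchanging `z` with `w`. -/
noncomputable def exchange : CotangentRing →+* CotangentRing := specialize x y w z s dx dy dw dz

theorem exchange_exchange (p : CotangentRing) : exchange (exchange p) = p := by
  have : exchange.comp exchange = RingHom.id _ := by
    apply hom_ext <;> simp [exchange]
  exact congrArg (fun f : CotangentRing →+* CotangentRing => f p) this

theorem exchange_mem {p : CotangentRing} (hp : p ∈ residualIdeal) : exchange p ∈ residualIdeal := by
  have h : residualIdeal ≤ residualIdeal.comap exchange := by
    have hv : exchange dv = dv := by
      simp [exchange, dv]
      ring
    refine residualIdeal_le_iff.2 ⟨?_, ?_, ?_, ?_, ?_, ?_, ?_⟩ <;> rw [Ideal.mem_comap]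
    · convert e₁_mem using 1
      simp [exchange, e₁]
    · convert e₃_mem using 1
      simp [exchange, e₂, e₃]
    · convert e₂_mem using 1
      simp [exchange, e₂, e₃]
    · convert e₄_mem using 1
      simp only [e₄, map_sub, map_mul, map_add, hv]
      simp [exchange]
    · convert neg_mem q₁_mem using 1
      simp [exchange, q₁]
      ring
    · convert q₃_mem using 1
      simp only [q₂, q₃, map_sub, map_mul, map_one, hv]
      simp [exchange]
    · convert q₂_mem using 1
      simp only [q₂, q₃, map_sub, map_mul, map_one, hv]
      simp [exchange]
  exact h hp

theorem mem_of_line'_mul_mem {p : CotangentRing} (hp : (x + y * w) * p ∈ residualIdeal) :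
    p ∈ residualIdeal := by
  rw [← exchange_exchange p]
  refine exchange_mem (mem_of_line_mul_mem ?_)
  convert exchange_mem hp using 1
  simp [exchange]

end NonZeroDivisors

section Kernel

/-- The element with `φ(tau) = y ^ 3 * (x + y * z) * (x + y * w) * t`. -/
noncomputable def tau : CotangentRing := y * dx - 2 * dv - dz - dw

/-- The coefficient of `t` in `φ(tau)`. -/
noncomputable def tauCoeff : MvPolynomial (Fin 4) ℂ :=
  X 1 ^ 3 * (X 0 + X 1 * X 2) * (X 0 + X 1 * X 3)

theorem base_tauCoeff : base tauCoeff = y ^ 3 * (x + y * z) * (x + y * w) := by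
  simp [tauCoeff, x, y, z, w]

theorem tauCoeff_ne_zero : tauCoeff ≠ 0 := by
  intro h
  simpa [tauCoeff] using congrArg (aeval ![(1 : ℂ), 1, 0, 0]) h

theorem mem_of_tauCoeff_mul_mem {p : CotangentRing} (hp : base tauCoeff * p ∈ residualIdeal) :
    p ∈ residualIdeal := by
  rw [base_tauCoeff] at hp
  refine mem_of_line'_mul_mem (mem_of_line_mul_mem (mem_of_y_mul_mem (mem_of_y_mul_mem
    (mem_of_y_mul_mem ?_))))
  convert hp using 1
  ring

theorem mem_of_tauCoeff_pow_mul_mem {p : CotangentRing} (n : ℕ)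
    (hp : base tauCoeff ^ n * p ∈ residualIdeal) : p ∈ residualIdeal := by
  induction n with
  | zero => simpa using hp
  | succ n ih => exact ih (mem_of_tauCoeff_mul_mem (by convert hp using 1; ring))

theorem exists_tauCoeff_mul_var_sub_mem (i : Fin 5) :
    ∃ r, base tauCoeff * var i - base r * tau ∈ linearIdeal := by
  have key : ∀ v ∈ ({s, dx, dy, dz, dw} : Set CotangentRing),
      ∃ r, base tauCoeff * v - base r * tau ∈ linearIdeal := by
    let x' : MvPolynomial (Fin 4) ℂ := X 0
    let y' : MvPolynomial (Fin 4) ℂ := X 1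
    let z' : MvPolynomial (Fin 4) ℂ := X 2
    let w' : MvPolynomial (Fin 4) ℂ := X 3
    have hx : base x' = x := rfl
    have hy : base y' = y := rfl
    have hz : base z' = z := rfl
    have hw : base w' = w := rfl
    have h5 := five_mul_fifth
    simp only [Set.mem_insert_iff, Set.mem_singleton_iff, forall_eq_or_imp, forall_eq,
      base_tauCoeff]
    refine ⟨⟨x' * (x' + y') * y' * (x' + y' * z') * (x' + y' * w'), ?_⟩,
      ⟨y' * (x' + y' * z') * (x' + y' * w') * (2 * x' + y') +
        y' * (x' + y' * w') * (x' * (x' + y')) + y' * (x' + y' * z') * (x' * (x' + y')), ?_⟩,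
      ⟨y' * (x' + y' * z') * (x' + y' * w') * x' + y' * (x' + y' * w') * z' * (x' * (x' + y')) +
        y' * (x' + y' * z') * w' * (x' * (x' + y')) +
        (x' + y' * z') * (x' + y' * w') * (x' * (x' + y')), ?_⟩,
      ⟨y' ^ 2 * (x' + y' * w') * (x' * (x' + y')), ?_⟩,
      ⟨y' ^ 2 * (x' + y' * z') * (x' * (x' + y')), ?_⟩⟩ <;>
    simp only [map_mul, map_add, map_pow, map_ofNat, hx, hy, hz, hw, linearIdeal]
    · refine mem_span_quadruple (5 * (y * (x + y * z) * (x + y * w) * (-(x + y) * y)))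
        (y * (x + y * z) * (x + y * w) * (x + y))
        (y * (x + y * z) * (x + y * w) * (x + y))
        (y * (x + y * z) * (x + y * w) * (2 * x + y)) ?_
      simp only [tau, dv, e₁, e₂, e₃, e₄]
      linear_combination (-(y * (x + y * z) * (x + y * w) * (-(x + y) * y))) *
        (x * dx + y * dy) * h5
    · refine mem_span_quadruple (5 * (2 * y * (x + y * z) * (x + y * w) * (-y) + (y * (x + y * w) +
        y * (x + y * z)) * (-(x + y) * y)))
        (2 * y * (x + y * z) * (x + y * w) + y * (x + y * w) * (y + (x + y)) + y * (x + y * z) *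
          (x + y))
        (2 * y * (x + y * z) * (x + y * w) + y * (x + y * w) * (x + y) + y * (x + y * z) * (y +
          (x + y)))
        (4 * y * (x + y * z) * (x + y * w) + (y * (x + y * w) + y * (x + y * z)) * (2 * x + y)) ?_
      simp only [tau, dv, e₁, e₂, e₃, e₄]
      linear_combination (-(2 * y * (x + y * z) * (x + y * w) * (-y) + (y * (x + y * w) + y * (x +
        y * z)) * (-(x + y) * y))) *
        (x * dx + y * dy) * h5
    · refine mem_span_quadruple (5 * (-y * (x + y * z) * (x + y * w) * y + (y * (x + y * w) * z +
        y * (x + y * z) * w + (x + y * z) * (x + y * w)) * (-(x + y) * y)))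
        (y * (x + y * z) * (x + y * w) + y * (x + y * w) * z * y + (y * (x + y * w) * z + y * (x +
          y * z) * w + (x + y * z) * (x + y * w)) * (x + y))
        (y * (x + y * z) * (x + y * w) + y * (x + y * z) * w * y + (y * (x + y * w) * z + y * (x +
          y * z) * w + (x + y * z) * (x + y * w)) * (x + y))
        (2 * y * (x + y * z) * (x + y * w) + (y * (x + y * w) * z + y * (x + y * z) * w + (x + y *
          z) * (x + y * w)) * (2 * x + y)) ?_
      simp only [tau, dv, e₁, e₂, e₃, e₄]
      linear_combination (-(-y * (x + y * z) * (x + y * w) * y + (y * (x + y * w) * z + y * (x +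
        y * z) * w + (x + y * z) * (x + y * w)) * (-(x + y) * y))) *
        (x * dx + y * dy) * h5
    · refine mem_span_quadruple (5 * (y ^ 2 * (x + y * w) * (-(x + y) * y)))
        (y ^ 2 * (x + y * w) * (y + x + y))
        (y ^ 2 * (x + y * w) * (x + y))
        (y ^ 2 * (x + y * w) * (2 * x + y)) ?_
      simp only [tau, dv, e₁, e₂, e₃, e₄]
      linear_combination (-(y ^ 2 * (x + y * w) * (-(x + y) * y))) *
        (x * dx + y * dy) * h5
    · refine mem_span_quadruple (5 * (y ^ 2 * (x + y * z) * (-(x + y) * y)))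
        (y ^ 2 * (x + y * z) * (x + y))
        (y ^ 2 * (x + y * z) * (y + x + y))
        (y ^ 2 * (x + y * z) * (2 * x + y)) ?_
      simp only [tau, dv, e₁, e₂, e₃, e₄]
      linear_combination (-(y ^ 2 * (x + y * z) * (-(x + y) * y))) *
        (x * dx + y * dy) * h5
  fin_cases i
  exacts [key s (by simp), key dx (by simp), key dy (by simp), key dz (by simp), key dw (by simp)]

theorem cotangent_induction {P : CotangentRing → Prop} (p : CotangentRing)
    (h_base : ∀ a, P (base a)) (h_add : ∀ p q, P p → P q → P (p + q))
    (h_mul : ∀ p i, P p → P (p * var i)) : P p :=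
  MvPolynomial.induction_on (motive := P) p h_base h_add h_mul

theorem exists_tauCoeff_pow_mul_sub_mem (p : CotangentRing) :
    ∃ (n : ℕ) (q : Polynomial (MvPolynomial (Fin 4) ℂ)),
      base tauCoeff ^ n * p - q.eval₂ base tau ∈ linearIdeal := by
  refine cotangent_induction (P := fun p =>
    ∃ (n : ℕ) (q : Polynomial (MvPolynomial (Fin 4) ℂ)),
      base tauCoeff ^ n * p - q.eval₂ base tau ∈ linearIdeal) p ?_ ?_ ?_
  · intro a
    refine ⟨0, Polynomial.C a, ?_⟩
    rw [Polynomial.eval₂_C, pow_zero, one_mul]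
    simp
  · rintro p₁ p₂ ⟨n₁, q₁, h₁⟩ ⟨n₂, q₂, h₂⟩
    refine ⟨n₁ + n₂, Polynomial.C (tauCoeff ^ n₂) * q₁ + Polynomial.C (tauCoeff ^ n₁) * q₂, ?_⟩
    convert add_mem (linearIdeal.mul_mem_left (base tauCoeff ^ n₂) h₁)
      (linearIdeal.mul_mem_left (base tauCoeff ^ n₁) h₂) using 1
    rw [Polynomial.eval₂_add, Polynomial.eval₂_mul, Polynomial.eval₂_mul, Polynomial.eval₂_C,
      Polynomial.eval₂_C, map_pow, map_pow]
    ring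
  · rintro p i ⟨n, q, h⟩
    obtain ⟨r, hr⟩ := exists_tauCoeff_mul_var_sub_mem i
    refine ⟨n + 1, q * (Polynomial.C r * Polynomial.X), ?_⟩
    convert add_mem (linearIdeal.mul_mem_left (base tauCoeff * var i) h)
      (linearIdeal.mul_mem_left (q.eval₂ base tau) hr) using 1
    rw [Polynomial.eval₂_mul, Polynomial.eval₂_mul, Polynomial.eval₂_C, Polynomial.eval₂_X]
    ring

/-- The map `φ` attached to the five lines divisor, as a ring homomorphism. -/
noncomputable def phi : CotangentRing →+* Polynomial (MvPolynomial (Fin 4) ℂ) :=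
  (reesPhi fiveLines fun j => pderiv j fiveLines).toRingHom

theorem phi_base (a : MvPolynomial (Fin 4) ℂ) : phi (base a) = Polynomial.C a :=
  (reesPhi fiveLines fun j => pderiv j fiveLines).commutes a

theorem phi_var (i : Fin 5) : phi (var i) =
    Polynomial.C ((Fin.cons fiveLines fun j => pderiv j fiveLines : Fin 5 → _) i) *
      Polynomial.X := by
  have : phi (var i) = (Fin.cons (Polynomial.C fiveLines * Polynomial.X) fun j =>
      Polynomial.C (pderiv j fiveLines) * Polynomial.X : Fin 5 → Polynomial _) i :=
    aeval_X _ _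
  rw [this]
  refine Fin.cases ?_ (fun j => ?_) i <;> simp

theorem pderiv_fiveLines (j : Fin 4) : pderiv j fiveLines =
    (![X 1 * (X 0 + X 1) * (X 0 + X 1 * X 2) * (X 0 + X 1 * X 3) +
        X 0 * X 1 * (X 0 + X 1 * X 2) * (X 0 + X 1 * X 3) +
        X 0 * X 1 * (X 0 + X 1) * (X 0 + X 1 * X 3) +
        X 0 * X 1 * (X 0 + X 1) * (X 0 + X 1 * X 2),
      X 0 * (X 0 + X 1) * (X 0 + X 1 * X 2) * (X 0 + X 1 * X 3) +
        X 0 * X 1 * (X 0 + X 1 * X 2) * (X 0 + X 1 * X 3) +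
        X 0 * X 1 * (X 0 + X 1) * X 2 * (X 0 + X 1 * X 3) +
        X 0 * X 1 * (X 0 + X 1) * (X 0 + X 1 * X 2) * X 3,
      X 0 * X 1 ^ 2 * (X 0 + X 1) * (X 0 + X 1 * X 3),
      X 0 * X 1 ^ 2 * (X 0 + X 1) * (X 0 + X 1 * X 2)] :
      Fin 4 → MvPolynomial (Fin 4) ℂ) j := by
  fin_cases j <;> simp [fiveLines, pderiv_X] <;> ring

/-- The linear form with the given coefficients. -/
noncomputable def linearForm (a : Fin 5 → MvPolynomial (Fin 4) ℂ) : CotangentRing :=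
  ∑ i, base (a i) * var i

theorem mem_kerOne_of_eq_linearForm {p : CotangentRing} {a : Fin 5 → MvPolynomial (Fin 4) ℂ}
    (hp : p = linearForm a)
    (h : ∑ i, a i * (Fin.cons fiveLines fun j => pderiv j fiveLines : Fin 5 → _) i = 0) :
    p ∈ (kerOne fiveLines fun j => pderiv j fiveLines : Ideal CotangentRing) := by
  subst hp
  refine Ideal.subset_span ⟨?_, ?_⟩
  · change phi (linearForm a) = 0
    simp only [linearForm, map_sum, map_mul, phi_base, phi_var, ← mul_assoc]
    simp only [← Polynomial.C_mul]
    rw [← Finset.sum_mul, ← map_sum, h, map_zero, zero_mul]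
  · exact IsHomogeneous.sum _ _ _ fun i _ => isHomogeneous_C_mul_X (a i) i

theorem phi_tau : phi tau = Polynomial.C tauCoeff * Polynomial.X := by
  have h : tauCoeff = X 1 * pderiv 0 fiveLines - 2 * (X 1 * pderiv 1 fiveLines -
      X 2 * pderiv 2 fiveLines - X 3 * pderiv 3 fiveLines - fiveLines) -
      pderiv 2 fiveLines - pderiv 3 fiveLines := by
    simp only [pderiv_fiveLines, Matrix.cons_val]
    simp only [tauCoeff, fiveLines]
    ring
  have hs : phi s = Polynomial.C fiveLines * Polynomial.X := phi_var 0
  have hdx : phi dx = Polynomial.C (pderiv 0 fiveLines) * Polynomial.X := phi_var 1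
  have hdy : phi dy = Polynomial.C (pderiv 1 fiveLines) * Polynomial.X := phi_var 2
  have hdz : phi dz = Polynomial.C (pderiv 2 fiveLines) * Polynomial.X := phi_var 3
  have hdw : phi dw = Polynomial.C (pderiv 3 fiveLines) * Polynomial.X := phi_var 4
  simp only [tau, dv, y, z, w, map_sub, map_mul, map_ofNat, phi_base, hs, hdx, hdy, hdz, hdw, h]
  ring

theorem sum_mul_derivatives (a : Fin 5 → MvPolynomial (Fin 4) ℂ) :
    ∑ i, a i * (Fin.cons fiveLines fun j => pderiv j fiveLines : Fin 5 → _) i =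
      a 0 * fiveLines + a 1 * (X 1 * (X 0 + X 1) * (X 0 + X 1 * X 2) * (X 0 + X 1 * X 3) +
        X 0 * X 1 * (X 0 + X 1 * X 2) * (X 0 + X 1 * X 3) +
        X 0 * X 1 * (X 0 + X 1) * (X 0 + X 1 * X 3) +
        X 0 * X 1 * (X 0 + X 1) * (X 0 + X 1 * X 2)) +
      a 2 * (X 0 * (X 0 + X 1) * (X 0 + X 1 * X 2) * (X 0 + X 1 * X 3) +
        X 0 * X 1 * (X 0 + X 1 * X 2) * (X 0 + X 1 * X 3) +
        X 0 * X 1 * (X 0 + X 1) * X 2 * (X 0 + X 1 * X 3) +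
        X 0 * X 1 * (X 0 + X 1) * (X 0 + X 1 * X 2) * X 3) +
      a 3 * (X 0 * X 1 ^ 2 * (X 0 + X 1) * (X 0 + X 1 * X 3)) +
      a 4 * (X 0 * X 1 ^ 2 * (X 0 + X 1) * (X 0 + X 1 * X 2)) := by
  rw [Fin.sum_univ_five]
  exact congr_arg₂ _ (congr_arg₂ _ (congr_arg₂ _ (congr_arg₂ _ rfl
    (congrArg _ (pderiv_fiveLines 0))) (congrArg _ (pderiv_fiveLines 1)))
    (congrArg _ (pderiv_fiveLines 2))) (congrArg _ (pderiv_fiveLines 3))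

theorem linearIdeal_le_kerOne :
    linearIdeal ≤ (kerOne fiveLines fun j => pderiv j fiveLines : Ideal CotangentRing) := by
  have h5 : (C (1 / 5) : MvPolynomial (Fin 4) ℂ) * 5 = 1 := by
    rw [← map_ofNat (C : ℂ →+* MvPolynomial (Fin 4) ℂ) 5, ← map_mul]
    norm_num
  refine linearIdeal_le_iff.2 ⟨?_, ?_, ?_, ?_⟩
  · refine mem_kerOne_of_eq_linearForm (a := ![-1, C (1 / 5) * X 0, C (1 / 5) * X 1, 0, 0]) ?_ ?_
    · simp only [linearForm, Fin.sum_univ_five, Matrix.cons_val, map_neg, map_mul, map_one,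
        map_zero]
      change fifth * (x * dx + y * dy) - s = -1 * s + fifth * x * dx + fifth * y * dy +
        0 * dz + 0 * dw
      ring
    · rw [sum_mul_derivatives]
      simp only [Matrix.cons_val, fiveLines]
      linear_combination X 0 * X 1 * (X 0 + X 1) * (X 0 + X 1 * X 2) * (X 0 + X 1 * X 3) * h5
  · refine mem_kerOne_of_eq_linearForm (a := ![-X 1, 0, 0, X 0 + X 1 * X 2, 0]) ?_ ?_
    · simp only [linearForm, Fin.sum_univ_five, Matrix.cons_val, map_neg, map_mul, map_add,
        map_zero]
      change (x + y * z) * dz - y * s = -y * s + 0 * dx + 0 * dy + (x + y * z) * dz + 0 * dw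
      ring
    · rw [sum_mul_derivatives]
      simp only [Matrix.cons_val, fiveLines]
      ring
  · refine mem_kerOne_of_eq_linearForm (a := ![-X 1, 0, 0, 0, X 0 + X 1 * X 3]) ?_ ?_
    · simp only [linearForm, Fin.sum_univ_five, Matrix.cons_val, map_neg, map_mul, map_add,
        map_zero]
      change (x + y * w) * dw - y * s = -y * s + 0 * dx + 0 * dy + 0 * dz + (x + y * w) * dw
      ring
    · rw [sum_mul_derivatives]
      simp only [Matrix.cons_val, fiveLines]
      ring
  · refine mem_kerOne_of_eq_linearForm (a := ![-(X 0 + 2 * X 1), 0, (X 0 + X 1) * X 1,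
      -((X 0 + X 1) * X 2), -((X 0 + X 1) * X 3)]) ?_ ?_
    · simp only [linearForm, Fin.sum_univ_five, Matrix.cons_val, map_neg, map_mul, map_add,
        map_zero,
        map_ofNat]
      change (x + y) * (y * dy - z * dz - w * dw - s) - y * s = -(x + 2 * y) * s + 0 * dx +
        (x + y) * y * dy + -((x + y) * z) * dz + -((x + y) * w) * dw
      ring
    · rw [sum_mul_derivatives]
      simp only [Matrix.cons_val, fiveLines]
      ring

theorem kerOne_le_ker : (kerOne fiveLines fun j => pderiv j fiveLines : Ideal CotangentRing) ≤
    RingHom.ker phi :=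
  Ideal.span_le.2 fun _ h => h.1

theorem fiveLines_ne_zero : fiveLines ≠ 0 := by
  intro h
  simpa [fiveLines, one_add_one_eq_two] using congrArg (aeval ![(1 : ℂ), 1, 0, 0]) h

theorem phi_eval₂_tau (q : Polynomial (MvPolynomial (Fin 4) ℂ)) :
    phi (q.eval₂ base tau) = q.comp (Polynomial.C tauCoeff * Polynomial.X) := by
  have h : phi.comp base = Polynomial.C := RingHom.ext phi_base
  rw [Polynomial.hom_eval₂, h, phi_tau, Polynomial.comp]

theorem base_fiveLines_mul_mem {p : CotangentRing} (hp : phi p = 0) :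
    base fiveLines * p ∈ linearIdeal := by
  obtain ⟨n, q, h⟩ := exists_tauCoeff_pow_mul_sub_mem p
  have hq : q.comp (Polynomial.C tauCoeff * Polynomial.X) = 0 := by
    have : phi _ = 0 := kerOne_le_ker (linearIdeal_le_kerOne h)
    rwa [map_sub, map_mul, hp, mul_zero, zero_sub, neg_eq_zero,
      phi_eval₂_tau] at this
  have hq' : q = 0 := by
    ext1 k
    have := congrArg (fun r => Polynomial.coeff r k) hq
    simpa [Polynomial.comp_C_mul_X_coeff, tauCoeff_ne_zero] using this
  rw [hq', Polynomial.eval₂_zero, sub_zero] at h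
  have := y_mul_mem (mem_of_tauCoeff_pow_mul_mem n (linearIdeal_le h))
  convert linearIdeal.mul_mem_left (base (X 0 * (X 0 + X 1) * (X 0 + X 1 * X 2) *
    (X 0 + X 1 * X 3))) this using 1
  simp only [fiveLines, map_mul, map_add, y]
  ring

theorem phi_eq_zero_of_mul_mem {p : CotangentRing} (hp : base fiveLines * p ∈
    (kerOne fiveLines fun j => pderiv j fiveLines : Ideal CotangentRing)) : phi p = 0 := by
  have h : phi (base fiveLines * p) = 0 := kerOne_le_ker hp
  rw [map_mul, phi_base] at h
  exact (mul_eq_zero.1 h).resolve_left (Polynomial.C_ne_zero.2 fiveLines_ne_zero)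

end Kernel

end FiveLines

/-- For the "five lines" divisor, with `g_j = ∂f/∂x_j`, one has
`ker φ = (ker^{(1)}φ : f)`: a polynomial `p ∈ A[s, ξ_1, …, ξ_4]` lies in `ker φ` if and
only if `f·p ∈ ker^{(1)}φ` (here `f` is regarded as a constant polynomial). -/
theorem fiveLines_ker_eq_colon :
    ∀ p : MvPolynomial (Fin 5) (MvPolynomial (Fin 4) ℂ),
      p ∈ RingHom.ker (reesPhi fiveLines fun j => pderiv j fiveLines) ↔
        C fiveLines * p ∈ kerOne fiveLines fun j => pderiv j fiveLines := by
  exact fun p => ⟨fun hp => FiveLines.linearIdeal_le_kerOne (FiveLines.base_fiveLines_mul_mem hp),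
    fun hp => FiveLines.phi_eq_zero_of_mul_mem hp⟩
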